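/- arXiv:1905.09245 — 2 statements merged into one kernel-verified Lean document; each statement's English description precedes it below -/
import Mathlib

section
/- Let X be a mean zero random vector in ℝ^n which satisfies the convex concentration property with constant B. Then there is a universal constant c > 0 such that for every n×n real matrix Y and every t > 0: P(|XᵀYX − E XᵀYX| > t) ≤ 2 exp( −c · min( t²/(2 B⁴ ‖Y‖_F²), t/(B² ‖Y‖) ) ), where ‖Y‖ is the operator norm and ‖Y‖_F the Frobenius norm of Y. -/
open MeasureTheory ProbabilityTheory Real ENNReal

/-- A random vector `X` in `ℝ^n` has the convex concentration property with constant `K`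
if every 1-Lipschitz convex function of `X` is integrable and concentrates
sub-Gaussianly with constant `K` around its mean. -/
def ConvexConcentration {Ω : Type*} [MeasurableSpace Ω] (μ : Measure Ω) {n : ℕ}
    (X : Ω → EuclideanSpace ℝ (Fin n)) (K : ℝ) : Prop :=
  ∀ φ : EuclideanSpace ℝ (Fin n) → ℝ, ConvexOn ℝ Set.univ φ → LipschitzWith 1 φ →
    Integrable (fun ω => φ (X ω)) μ ∧
      ∀ t > (0:ℝ), (μ {ω | |φ (X ω) - ∫ ω', φ (X ω') ∂μ| ≥ t}).toReal ≤
        2 * Real.exp (-t ^ 2 / K ^ 2)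

/-- The convex concentration property, rescaled to convex functions of arbitrary Lipschitz
constant. -/
theorem ConvexConcentration.lipschitz {Ω : Type*} [MeasurableSpace Ω] {P : Measure Ω} {n : ℕ}
    {X : Ω → EuclideanSpace ℝ (Fin n)} {B : ℝ} (hX : ConvexConcentration P X B) (hB : 0 < B)
    {φ : EuclideanSpace ℝ (Fin n) → ℝ} {K : ℝ} (hK : 0 < K) (hφ : ConvexOn ℝ Set.univ φ)
    (hlip : ∀ x y, |φ x - φ y| ≤ K * ‖x - y‖) :
    Integrable (fun ω => φ (X ω)) P ∧
      ∀ r > (0 : ℝ), P.real {ω | K * B * r ≤ |φ (X ω) - ∫ ω', φ (X ω') ∂P|} ≤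
        2 * Real.exp (-r ^ 2) := by
  obtain ⟨hint, htail⟩ := hX (fun x => K⁻¹ * φ x) (by
    simpa only [smul_eq_mul] using hφ.smul (inv_nonneg.2 hK.le)) (by
      refine LipschitzWith.of_dist_le_mul fun x y => ?_
      rw [Real.dist_eq, ← mul_sub, abs_mul, abs_of_pos (inv_pos.2 hK), dist_eq_norm,
        NNReal.coe_one, one_mul, inv_mul_le_iff₀ hK]
      exact hlip x y)
  refine ⟨by simpa [mul_inv_cancel_left₀ hK.ne'] using hint.const_mul K, fun r hr => ?_⟩
  have h := htail (B * r) (by positivity)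
  have hexp : -(B * r) ^ 2 / B ^ 2 = -r ^ 2 := by field_simp
  rw [hexp] at h
  refine le_trans (le_of_eq ?_) h
  rw [measureReal_def]
  congr 3 with ω
  rw [integral_const_mul, ← mul_sub, abs_mul, abs_of_pos (inv_pos.2 hK), ge_iff_le,
    le_inv_mul_iff₀ hK, mul_assoc]

/-- Convex concentration is preserved by linear isometries. -/
theorem ConvexConcentration.linearIsometryEquiv {Ω : Type*} [MeasurableSpace Ω] {P : Measure Ω}
    {n : ℕ} {X : Ω → EuclideanSpace ℝ (Fin n)} {B : ℝ} (hX : ConvexConcentration P X B)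
    (U : EuclideanSpace ℝ (Fin n) ≃ₗᵢ[ℝ] EuclideanSpace ℝ (Fin n)) :
    ConvexConcentration P (fun ω => U (X ω)) B := fun φ hφ hlip =>
  hX (fun x => φ (U x)) (hφ.comp_linearMap U.toLinearEquiv.toLinearMap)
    (by
    have h := hlip.comp U.lipschitz
    rw [one_mul] at h
    exact h)

/-- A nonnegative function with an exponential tail has a correspondingly bounded integral. -/
theorem integrable_and_integral_le_of_exp_tail {Ω : Type*} [MeasurableSpace Ω] {P : Measure Ω}
    [IsFiniteMeasure P] {W : Ω → ℝ} (hW : AEMeasurable W P) (hW0 : ∀ ω, 0 ≤ W ω) {a C : ℝ}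
    (ha : 0 < a) (hC : 0 ≤ C)
    (htail : ∀ v > (0 : ℝ), P.real {ω | a * v ≤ W ω} ≤ C * Real.exp (-v)) :
    Integrable W P ∧ ∫ ω, W ω ∂P ≤ C * a := by
  have hint : IntegrableOn (fun t : ℝ => C * Real.exp (-a⁻¹ * t)) (Set.Ioi 0) :=
    (integrableOn_exp_mul_Ioi (by simpa using ha) 0).const_mul C
  have hval : ∫ t in Set.Ioi (0 : ℝ), C * Real.exp (-a⁻¹ * t) = C * a := by
    rw [integral_const_mul, integral_exp_mul_Ioi (by simpa using ha)]
    simp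
  have hle : ∫⁻ ω, ENNReal.ofReal (W ω) ∂P ≤ ENNReal.ofReal (C * a) := by
    rw [lintegral_eq_lintegral_meas_le P (Filter.Eventually.of_forall hW0) hW, ← hval,
      ofReal_integral_eq_lintegral_ofReal hint
        (Filter.Eventually.of_forall fun t => by positivity)]
    refine setLIntegral_mono' measurableSet_Ioi fun t ht => ?_
    have h := htail (a⁻¹ * t) (mul_pos (inv_pos.2 ha) ht)
    rw [mul_inv_cancel_left₀ ha.ne'] at h
    rw [← ofReal_measureReal]
    exact ENNReal.ofReal_le_ofReal (by simpa using h)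
  refine ⟨⟨hW.aestronglyMeasurable, ?_⟩, ?_⟩
  · rw [hasFiniteIntegral_iff_ofReal (Filter.Eventually.of_forall hW0)]
    exact hle.trans_lt ENNReal.ofReal_lt_top
  · rw [integral_eq_lintegral_of_nonneg_ae (Filter.Eventually.of_forall hW0)
      hW.aestronglyMeasurable]
    exact ENNReal.toReal_le_of_le_ofReal (by positivity) hle

/-- The coordinates of a centred vector with the convex concentration property have second moment
at most `2 * B ^ 2`. -/
theorem ConvexConcentration.integral_sq_coord_le {Ω : Type*} [MeasurableSpace Ω] {P : Measure Ω}
    [IsProbabilityMeasure P] {n : ℕ} {X : Ω → EuclideanSpace ℝ (Fin n)} {B : ℝ}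
    (hX : ConvexConcentration P X B) (hB : 0 < B) (hmeas : Measurable X) (i : Fin n)
    (hmean : ∫ ω, X ω i ∂P = 0) :
    Integrable (fun ω => X ω i ^ 2) P ∧ ∫ ω, X ω i ^ 2 ∂P ≤ 2 * B ^ 2 := by
  obtain ⟨-, htail⟩ := hX.lipschitz hB (φ := fun x => x i) one_pos
    ⟨convex_univ, fun x _ y _ a b _ _ _ => by simp⟩ (fun x y => by
      simpa using PiLp.norm_apply_le (x - y) i)
  refine integrable_and_integral_le_of_exp_tail (by fun_prop) (fun ω => sq_nonneg _)
    (by positivity) zero_le_two fun v hv => ?_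
  have h := htail (√v) (Real.sqrt_pos.2 hv)
  rw [Real.sq_sqrt hv.le, hmean] at h
  refine le_trans (measureReal_mono fun ω hω => ?_) h
  simp only [Set.mem_ofPred_eq, sub_zero, one_mul] at hω ⊢
  rw [← Real.sqrt_sq hB.le, ← Real.sqrt_mul (sq_nonneg B), ← Real.sqrt_sq_eq_abs]
  exact Real.sqrt_le_sqrt hω

/-- A pointwise bounded supremum of affine functions is convex. -/
theorem convexOn_iSup_of_affine {ι E : Type*} [Nonempty ι] [AddCommGroup E] [Module ℝ E]
    (l : ι → E →ₗ[ℝ] ℝ) (k : ι → ℝ) (hbdd : ∀ x, BddAbove (Set.range fun j => l j x + k j)) :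
    ConvexOn ℝ Set.univ fun x => ⨆ j, (l j x + k j) := by
  refine ⟨convex_univ, fun x _ y _ a b ha hb hab => ciSup_le fun j => ?_⟩
  have hx := mul_le_mul_of_nonneg_left (le_ciSup (hbdd x) j) ha
  have hy := mul_le_mul_of_nonneg_left (le_ciSup (hbdd y) j) hb
  simp only [map_add, map_smul, smul_eq_mul] at hx hy ⊢
  calc a * l j x + b * l j y + k j = a * (l j x + k j) + b * (l j y + k j) := by
        linear_combination (-k j) * hab
    _ ≤ _ := add_le_add hx hy

/-- A pointwise bounded supremum of functions with a common Lipschitz constant is Lipschitz. -/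
theorem abs_iSup_sub_iSup_le {ι E : Type*} [Nonempty ι] [SeminormedAddCommGroup E]
    {h : ι → E → ℝ} {K : ℝ} (hbdd : ∀ x, BddAbove (Set.range fun j => h j x))
    (hlip : ∀ j x y, h j x - h j y ≤ K * ‖x - y‖) (x y : E) :
    |(⨆ j, h j x) - ⨆ j, h j y| ≤ K * ‖x - y‖ := by
  have key : ∀ x y, (⨆ j, h j x) - ⨆ j, h j y ≤ K * ‖x - y‖ := fun x y => by
    rw [sub_le_iff_le_add]
    exact ciSup_le fun j => by linarith [hlip j x y, le_ciSup (hbdd y) j]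
  rw [abs_sub_le_iff]
  exact ⟨key x y, norm_sub_rev x y ▸ key y x⟩

/-- If `W` concentrates, at every scale `s`, around some point depending on `s`, then it
concentrates around its mean. -/
theorem tail_sub_integral_of_tail_sub_scale {Ω : Type*} [MeasurableSpace Ω] {P : Measure Ω}
    [IsProbabilityMeasure P] {W : Ω → ℝ} (hW : Measurable W) {a b : ℝ} (ha : 0 < a)
    (hb : 0 < b) (hba : b ≤ a)
    (htail : ∀ s > (0 : ℝ), ∃ m, P.real {ω | 2 * a * s + b * s ^ 2 ≤ |W ω - m|} ≤
      4 * Real.exp (-s ^ 2)) :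
    Integrable W P ∧ ∀ s ≥ (2 : ℝ),
      P.real {ω | 103 * (2 * a * s + b * s ^ 2) ≤ |W ω - ∫ ω', W ω' ∂P|} ≤
        4 * Real.exp (-s ^ 2) := by
  have he4 : (16 : ℝ) ≤ Real.exp 4 ∧ Real.exp 4 ≤ 60 := by
    have h1 := Real.exp_one_gt_d9
    have h2 := Real.exp_one_lt_d9
    have h4 : Real.exp 4 = Real.exp 1 ^ 4 := by rw [← Real.exp_nat_mul]; norm_num
    rw [h4]
    constructor
    · calc (16 : ℝ) = 2 ^ 4 := by norm_num
        _ ≤ _ := by gcongr; linarith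
    · calc Real.exp 1 ^ 4 ≤ 2.72 ^ 4 := by gcongr; linarith
        _ ≤ 60 := by norm_num
  have hsmall : ∀ s ≥ (2 : ℝ), 4 * Real.exp (-s ^ 2) < 1 / 2 := fun s hs => by
    have h1 : Real.exp (-s ^ 2) ≤ (Real.exp 4)⁻¹ := by
      rw [← Real.exp_neg]; exact Real.exp_le_exp.2 (by nlinarith)
    have h2 : (Real.exp 4)⁻¹ ≤ 16⁻¹ := inv_anti₀ (by norm_num) he4.1
    linarith
  obtain ⟨m, hm⟩ := htail 2 two_pos
  have hcenter : ∀ s ≥ (2 : ℝ), P.real {ω | 3 * (2 * a * s + b * s ^ 2) ≤ |W ω - m|} ≤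
      4 * Real.exp (-s ^ 2) := by
    intro s hs
    obtain ⟨m', hm'⟩ := htail s (by linarith)
    obtain ⟨ω₀, h₀, h₀'⟩ : ∃ ω, |W ω - m| < 2 * a * 2 + b * 2 ^ 2 ∧
        |W ω - m'| < 2 * a * s + b * s ^ 2 := by
      by_contra! hcon
      have hcover : (Set.univ : Set Ω) ⊆ {ω | 2 * a * 2 + b * 2 ^ 2 ≤ |W ω - m|} ∪
          {ω | 2 * a * s + b * s ^ 2 ≤ |W ω - m'|} := fun ω _ =>
        (le_or_gt (2 * a * 2 + b * 2 ^ 2) |W ω - m|).imp id (hcon ω)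
      have h1 := (measureReal_mono hcover).trans (measureReal_union_le (μ := P) _ _)
      rw [probReal_univ] at h1
      exact absurd (h1.trans_lt (add_lt_add (hm.trans_lt (hsmall 2 le_rfl))
        (hm'.trans_lt (hsmall s hs)))) (by norm_num)
    have hmono : 2 * a * 2 + b * 2 ^ 2 ≤ 2 * a * s + b * s ^ 2 := by gcongr
    refine le_trans (measureReal_mono fun ω hω => ?_) hm'
    simp only [Set.mem_ofPred_eq] at hω ⊢
    have h1 : |W ω - m| ≤ |W ω - m'| + |W ω₀ - m'| + |W ω₀ - m| := by
      calc |W ω - m| = |(W ω - m') - (W ω₀ - m') + (W ω₀ - m)| := by ring_nf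
        _ ≤ |(W ω - m') - (W ω₀ - m')| + |W ω₀ - m| := abs_add_le _ _
        _ ≤ _ := by gcongr; exact abs_sub _ _
    linarith
  obtain ⟨hint, hle⟩ := integrable_and_integral_le_of_exp_tail (P := P)
    (W := fun ω => |W ω - m|) (by fun_prop) (fun ω => abs_nonneg _)
    (a := 6 * a) (C := Real.exp 4) (by positivity) (Real.exp_nonneg 4) fun v hv => by
      rcases le_total v 4 with hv4 | hv4
      · refine measureReal_le_one.trans ?_
        rw [← Real.exp_add]
        exact Real.one_le_exp (by linarith)
      · have hs : (2 : ℝ) ≤ √v := Real.le_sqrt_of_sq_le (by linarith)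
        have h := hcenter (√v) hs
        rw [Real.sq_sqrt hv.le] at h
        refine (measureReal_mono fun ω hω => ?_).trans
          (h.trans (by gcongr; linarith [he4.1]))
        simp only [Set.mem_ofPred_eq] at hω ⊢
        have h1 : √v ≤ v / 2 := by nlinarith [Real.sq_sqrt hv.le]
        nlinarith
  have hWint : Integrable W P := by
    have h : Integrable (fun ω => W ω - m) P :=
      (integrable_norm_iff (by fun_prop)).1 (by simpa only [Real.norm_eq_abs] using hint)
    exact (h.add (integrable_const m)).congr (by filter_upwards with ω; simp)
  refine ⟨hWint, fun s hs => (measureReal_mono fun ω hω => ?_).trans (hcenter s hs)⟩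
  simp only [Set.mem_ofPred_eq] at hω ⊢
  have hmean : |m - ∫ ω', W ω' ∂P| ≤ 360 * a := by
    have h1 : (∫ ω', W ω' ∂P) - m = ∫ ω', (W ω' - m) ∂P := by
      rw [integral_sub hWint (integrable_const m)]; simp
    rw [abs_sub_comm, h1]
    refine abs_integral_le_integral_abs.trans (hle.trans ?_)
    nlinarith [he4.2]
  have h1 : |W ω - ∫ ω', W ω' ∂P| ≤ |W ω - m| + |m - ∫ ω', W ω' ∂P| := abs_sub_le _ _ _
  nlinarith [mul_le_mul_of_nonneg_left hs ha.le, mul_pos hb (by positivity : 0 < s ^ 2)]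

/-- Deviation of a nonnegative diagonal quadratic form at scale `s` from some point. -/
theorem ConvexConcentration.exists_diagonal_tail {Ω : Type*} [MeasurableSpace Ω] {P : Measure Ω}
    [IsProbabilityMeasure P] {n : ℕ} {X : Ω → EuclideanSpace ℝ (Fin n)} {B : ℝ}
    (hX : ConvexConcentration P X B) (hB : 0 < B) (hmeas : Measurable X)
    (hmean : ∀ i, ∫ ω, X ω i ∂P = 0) {l : Fin n → ℝ} {L F : ℝ} (hl : ∀ i, 0 ≤ l i)
    (hL : 0 < L) (hlL : ∀ i, l i ≤ L) (hF : 0 < F) (hlF : ∑ i, l i ^ 2 ≤ F ^ 2)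
    {s : ℝ} (hs : 0 < s) :
    ∃ m, P.real {ω | 2 * (2 * B ^ 2 * F) * s + 2 * B ^ 2 * L * s ^ 2 ≤
      |∑ i, l i * X ω i ^ 2 - m|} ≤ 4 * Real.exp (-s ^ 2) := by
  set D : EuclideanSpace ℝ (Fin n) →ₗ[ℝ] EuclideanSpace ℝ (Fin n) :=
    Matrix.toLpLin 2 2 (Matrix.diagonal l)
  have hD : ∀ x i, D x i = l i * x i := fun x i => by
    simp [D, Matrix.toLpLin_apply, Matrix.mulVec_diagonal]
  have hDsq : ∀ x, ‖D x‖ ^ 2 = ∑ i, l i ^ 2 * x i ^ 2 := fun x => by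
    simp [EuclideanSpace.norm_sq_eq, hD, mul_pow]
  have hDL : ∀ x, ‖D x‖ ≤ L * ‖x‖ := fun x => by
    refine le_of_sq_le_sq ?_ (by positivity)
    rw [hDsq, mul_pow, EuclideanSpace.norm_sq_eq, Finset.mul_sum]
    refine Finset.sum_le_sum fun i _ => ?_
    rw [Real.norm_eq_abs, sq_abs]
    gcongr
    exacts [hl i, hlL i]
  set M := B * (2 * F + L * s)
  have hM : 0 < M := by positivity
  -- The gradient `2 * D X` is bounded by `2 * M` outside an event of small probability.
  have hgrad : P.real {ω | M ≤ ‖D (X ω)‖} ≤ 2 * Real.exp (-s ^ 2) := by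
    obtain ⟨hint, htail⟩ := hX.lipschitz hB (φ := fun x => ‖D x‖) hL
      ((convexOn_norm convex_univ).comp_linearMap D) fun x y => by
        refine (abs_norm_sub_norm_le _ _).trans ?_
        rw [← map_sub]
        exact hDL _
    have hsq : Integrable (fun ω => ‖D (X ω)‖ ^ 2) P ∧
        ∫ ω, ‖D (X ω)‖ ^ 2 ∂P ≤ 2 * B ^ 2 * F ^ 2 := by
      have hi := fun i => hX.integral_sq_coord_le hB hmeas i (hmean i)
      simp only [hDsq]
      refine ⟨integrable_finsetSum _ fun i _ => (hi i).1.const_mul _, ?_⟩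
      rw [integral_finsetSum _ fun i _ => (hi i).1.const_mul _]
      calc ∑ i, ∫ ω, l i ^ 2 * X ω i ^ 2 ∂P ≤ ∑ i, l i ^ 2 * (2 * B ^ 2) := by
            refine Finset.sum_le_sum fun i _ => ?_
            rw [integral_const_mul]
            exact mul_le_mul_of_nonneg_left (hi i).2 (sq_nonneg _)
        _ = (2 * B ^ 2) * ∑ i, l i ^ 2 := by rw [← Finset.sum_mul, mul_comm]
        _ ≤ _ := by gcongr
    have hmeanD : ∫ ω, ‖D (X ω)‖ ∂P ≤ 2 * B * F := by
      have hBF : 0 < B * F := by positivity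
      have h1 : ∫ ω, ‖D (X ω)‖ ∂P ≤ ∫ ω, ((4 * (B * F))⁻¹ * ‖D (X ω)‖ ^ 2 + B * F) ∂P := by
        refine integral_mono hint ((hsq.1.const_mul _).add (integrable_const _)) fun ω => ?_
        have h2 : (4 * (B * F))⁻¹ * ‖D (X ω)‖ ^ 2 + B * F - ‖D (X ω)‖ =
            (4 * (B * F))⁻¹ * (‖D (X ω)‖ - 2 * (B * F)) ^ 2 := by
          field_simp; ring
        have h3 : 0 ≤ (4 * (B * F))⁻¹ * (‖D (X ω)‖ - 2 * (B * F)) ^ 2 := by positivity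
        simp only
        linarith
      rw [integral_add (hsq.1.const_mul _) (integrable_const _), integral_const_mul] at h1
      have h4 : (4 * (B * F))⁻¹ * ∫ ω, ‖D (X ω)‖ ^ 2 ∂P ≤ (4 * (B * F))⁻¹ * (2 * B ^ 2 * F ^ 2) :=
        mul_le_mul_of_nonneg_left hsq.2 (by positivity)
      have h5 : (4 * (B * F))⁻¹ * (2 * B ^ 2 * F ^ 2) = B * F / 2 := by field_simp; norm_num
      simp only [integral_const, probReal_univ, one_smul] at h1
      linarith
    refine (measureReal_mono fun ω hω => ?_).trans (htail s hs)
    simp only [Set.mem_ofPred_eq, M] at hω ⊢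
    refine le_trans ?_ (le_abs_self _)
    linarith
  -- The supremum of the tangents to the form at points where the gradient is small.
  let T := {y : EuclideanSpace ℝ (Fin n) // ‖D y‖ ≤ M}
  have : Nonempty T := ⟨⟨0, by simpa using hM.le⟩⟩
  let h : T → EuclideanSpace ℝ (Fin n) → ℝ := fun y x =>
    (innerₛₗ ℝ ((2 : ℝ) • D y.1)) x + (-∑ i, l i * y.1 i ^ 2)
  have hh : ∀ (y : T) x, h y x = ∑ i, l i * x i ^ 2 - ∑ i, l i * (x i - y.1 i) ^ 2 := by
    intro y x
    simp only [h, innerₛₗ_apply_apply, PiLp.inner_apply, PiLp.smul_apply, hD,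
      ← Finset.sum_neg_distrib, ← Finset.sum_add_distrib, ← Finset.sum_sub_distrib]
    refine Finset.sum_congr rfl fun i _ => ?_
    simp
    ring
  have hle : ∀ (y : T) x, h y x ≤ ∑ i, l i * x i ^ 2 := fun y x => by
    rw [hh, sub_le_self_iff]
    exact Finset.sum_nonneg fun i _ => mul_nonneg (hl i) (sq_nonneg _)
  have hbdd : ∀ x, BddAbove (Set.range fun y => h y x) := fun x =>
    ⟨_, Set.forall_mem_range.2 fun y => hle y x⟩
  have heq : ∀ x, ‖D x‖ ≤ M → (⨆ y, h y x) = ∑ i, l i * x i ^ 2 := fun x hx =>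
    le_antisymm (ciSup_le fun y => hle y x) (by
      simpa [hh] using le_ciSup (hbdd x) (⟨x, hx⟩ : T))
  obtain ⟨-, htail⟩ := hX.lipschitz hB (φ := fun x => ⨆ y, h y x) (K := 2 * M) (by positivity)
    (convexOn_iSup_of_affine _ _ hbdd) (abs_iSup_sub_iSup_le hbdd fun y x z => by
      have h1 : h y x - h y z = inner ℝ ((2 : ℝ) • D y.1) (x - z) := by
        simp only [h, innerₛₗ_apply_apply, inner_sub_right]; ring
      rw [h1]
      refine (real_inner_le_norm _ _).trans ?_
      rw [norm_smul, Real.norm_two]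
      gcongr
      exact y.2)
  refine ⟨∫ ω, (⨆ y, h y (X ω)) ∂P, ?_⟩
  calc _ ≤ P.real ({ω | M ≤ ‖D (X ω)‖} ∪ {ω | 2 * M * B * s ≤
            |(⨆ y, h y (X ω)) - ∫ ω', (⨆ y, h y (X ω')) ∂P|}) := by
        refine measureReal_mono fun ω hω => ?_
        rcases le_total M ‖D (X ω)‖ with h1 | h1
        · exact Or.inl h1
        · refine Or.inr ?_
          simp only [Set.mem_ofPred_eq] at hω ⊢
          rw [heq _ h1]
          refine le_trans (le_of_eq ?_) hω
          simp only [M]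
          ring
    _ ≤ _ := measureReal_union_le _ _
    _ ≤ _ := by linarith [htail s hs]

/-- Concentration of a diagonal quadratic form around its mean. -/
theorem ConvexConcentration.diagonal_tail {Ω : Type*} [MeasurableSpace Ω] {P : Measure Ω}
    [IsProbabilityMeasure P] {n : ℕ} {X : Ω → EuclideanSpace ℝ (Fin n)} {B : ℝ}
    (hX : ConvexConcentration P X B) (hB : 0 < B) (hmeas : Measurable X)
    (hmean : ∀ i, ∫ ω, X ω i ∂P = 0) {l : Fin n → ℝ} {L F : ℝ}
    (hL : 0 < L) (hlL : ∀ i, |l i| ≤ L) (hLF : L ≤ F) (hlF : ∑ i, l i ^ 2 ≤ F ^ 2)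
    {s : ℝ} (hs : 2 ≤ s) :
    P.real {ω | 412 * B ^ 2 * (2 * F * s + L * s ^ 2) ≤
      |∑ i, l i * X ω i ^ 2 - ∫ ω', ∑ i, l i * X ω' i ^ 2 ∂P|} ≤ 8 * Real.exp (-s ^ 2) := by
  have hF := hL.trans_le hLF
  have hnonneg : ∀ k : Fin n → ℝ, (∀ i, 0 ≤ k i) → (∀ i, k i ≤ |l i|) →
      Integrable (fun ω => ∑ i, k i * X ω i ^ 2) P ∧
      P.real {ω | 103 * (2 * (2 * B ^ 2 * F) * s + 2 * B ^ 2 * L * s ^ 2) ≤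
        |∑ i, k i * X ω i ^ 2 - ∫ ω', ∑ i, k i * X ω' i ^ 2 ∂P|} ≤
          4 * Real.exp (-s ^ 2) := by
    intro k hk hkl
    have hkF : ∑ i, k i ^ 2 ≤ F ^ 2 := le_trans (Finset.sum_le_sum fun i _ => by
      rw [← sq_abs (l i)]; exact pow_le_pow_left₀ (hk i) (hkl i) 2) hlF
    obtain ⟨hint, htail⟩ := tail_sub_integral_of_tail_sub_scale (P := P)
      (W := fun ω => ∑ i, k i * X ω i ^ 2) (by fun_prop) (a := 2 * B ^ 2 * F)
      (b := 2 * B ^ 2 * L) (by positivity) (by positivity) (by gcongr) fun s hs =>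
        hX.exists_diagonal_tail hB hmeas hmean hk hL (fun i => (hkl i).trans (hlL i)) hF hkF hs
    exact ⟨hint, htail s hs⟩
  obtain ⟨hint₁, htail₁⟩ := hnonneg (fun i => (l i)⁺) (fun i => posPart_nonneg _)
    fun i => by rw [← posPart_add_negPart]; linarith [negPart_nonneg (l i)]
  obtain ⟨hint₂, htail₂⟩ := hnonneg (fun i => (l i)⁻) (fun i => negPart_nonneg _)
    fun i => by rw [← posPart_add_negPart]; linarith [posPart_nonneg (l i)]
  have hsplit : ∀ ω, ∑ i, l i * X ω i ^ 2 =
      ∑ i, (l i)⁺ * X ω i ^ 2 - ∑ i, (l i)⁻ * X ω i ^ 2 := fun ω => by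
    rw [← Finset.sum_sub_distrib]
    exact Finset.sum_congr rfl fun i _ => by rw [← sub_mul, posPart_sub_negPart]
  simp only [hsplit]
  rw [integral_sub hint₁ hint₂]
  refine (measureReal_mono (fun ω hω => ?_)).trans
    ((measureReal_union_le _ _).trans ((add_le_add htail₁ htail₂).trans (by linarith)))
  simp only [Set.mem_union, Set.mem_ofPred_eq] at hω ⊢
  by_contra! hcon
  have h1 := abs_sub (∑ i, (l i)⁺ * X ω i ^ 2 - ∫ ω', ∑ i, (l i)⁺ * X ω' i ^ 2 ∂P)
    (∑ i, (l i)⁻ * X ω i ^ 2 - ∫ ω', ∑ i, (l i)⁻ * X ω' i ^ 2 ∂P)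
  rw [sub_sub_sub_comm] at h1
  linarith

/-- A real quadratic form is diagonal in some orthonormal basis, with coefficients bounded by the
operator norm and square-summing to at most the squared Frobenius norm. -/
theorem Matrix.exists_orthonormalBasis_quadraticForm {n : ℕ} (Y : Matrix (Fin n) (Fin n) ℝ) :
    ∃ (v : OrthonormalBasis (Fin n) ℝ (EuclideanSpace ℝ (Fin n))) (l : Fin n → ℝ),
      (∀ x : EuclideanSpace ℝ (Fin n),
        ∑ i, ∑ j, x i * Y i j * x j = ∑ i, l i * v.repr x i ^ 2) ∧
      (∀ i, |l i| ≤ ‖Matrix.toEuclideanCLM (𝕜 := ℝ) Y‖) ∧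
      ∑ i, l i ^ 2 ≤ ∑ i, ∑ j, Y i j ^ 2 := by
  set T := Matrix.toEuclideanCLM (𝕜 := ℝ) Y
  set S : EuclideanSpace ℝ (Fin n) →L[ℝ] EuclideanSpace ℝ (Fin n) :=
    (1 / 2 : ℝ) • (T + ContinuousLinearMap.adjoint T)
  have hST : ∀ x, inner ℝ x (S x) = inner ℝ x (T x) := fun x => by
    simp only [S, _root_.smul_apply, _root_.add_apply,
      inner_smul_right, inner_add_right, ContinuousLinearMap.adjoint_inner_right]
    rw [real_inner_comm x (T x)]
    ring
  have hS : (S : EuclideanSpace ℝ (Fin n) →ₗ[ℝ] EuclideanSpace ℝ (Fin n)).IsSymmetric := by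
    intro x y
    simp only [S, ContinuousLinearMap.coe_coe, _root_.smul_apply,
      _root_.add_apply, inner_smul_right, inner_add_right, inner_smul_left,
      inner_add_left, ContinuousLinearMap.adjoint_inner_right,
      ContinuousLinearMap.adjoint_inner_left, conj_trivial]
    ring
  have hn : Module.finrank ℝ (EuclideanSpace ℝ (Fin n)) = n := by simp
  set v := hS.eigenvectorBasis hn
  set l := hS.eigenvalues hn
  have hv : ∀ i, S (v i) = l i • v i := fun i => hS.apply_eigenvectorBasis hn i
  have hT : ∀ x : EuclideanSpace ℝ (Fin n),
      ∑ i, ∑ j, x i * Y i j * x j = inner ℝ x (T x) := fun x => by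
    rw [Matrix.inner_toEuclideanCLM]
    simp [dotProduct, Matrix.mulVec, Finset.mul_sum, mul_assoc]
  have hl : ∀ i, l i = inner ℝ (v i) (T (v i)) := fun i => by
    rw [← hST, hv, inner_smul_right, real_inner_self_eq_norm_sq, v.norm_eq_one]
    simp
  have hlT : ∀ i, |l i| ≤ ‖T (v i)‖ := fun i => by
    rw [hl]
    simpa [v.norm_eq_one] using abs_real_inner_le_norm (v i) (T (v i))
  refine ⟨v, l, fun x => ?_, fun i => (hlT i).trans ?_, ?_⟩
  · rw [hT, ← hST, ← v.sum_inner_mul_inner]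
    refine Finset.sum_congr rfl fun i _ => ?_
    have h1 : inner ℝ (v i) (S x) = inner ℝ (S (v i)) x := (hS (v i) x).symm
    rw [h1, hv, inner_smul_left, v.repr_apply_apply, real_inner_comm x (v i), conj_trivial]
    ring
  · simpa [v.norm_eq_one] using T.le_opNorm (v i)
  · calc ∑ i, l i ^ 2 ≤ ∑ i, ∑ k, ‖inner ℝ (v i) (WithLp.toLp 2 (Y k))‖ ^ 2 := by
          refine Finset.sum_le_sum fun i _ => ?_
          rw [← sq_abs]
          refine (pow_le_pow_left₀ (abs_nonneg _) (hlT i) 2).trans (le_of_eq ?_)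
          rw [EuclideanSpace.norm_sq_eq]
          simp [T, Matrix.mulVec, PiLp.inner_apply, dotProduct]
      _ = ∑ k, ‖WithLp.toLp 2 (Y k)‖ ^ 2 := by
          rw [Finset.sum_comm]
          exact Finset.sum_congr rfl fun k _ => v.sum_sq_norm_inner_right _
      _ = _ := by simp [EuclideanSpace.norm_sq_eq]

/-- Hanson–Wright inequality for mean-zero random vectors with the convex
concentration property (Adamczak, Theorem 2.5). -/
theorem hanson_wright_convex_concentration :
    ∃ c > (0:ℝ), ∀ (n : ℕ) (Ω : Type) (_ : MeasurableSpace Ω) (P : Measure Ω)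
      (_ : IsProbabilityMeasure P) (X : Ω → EuclideanSpace ℝ (Fin n)) (B : ℝ)
      (Y : Matrix (Fin n) (Fin n) ℝ),
      Measurable X →
      (∀ i, ∫ ω, X ω i ∂P = 0) →
      0 < B → ConvexConcentration P X B →
      ∀ t > (0:ℝ),
        (P {ω | |(∑ i, ∑ j, X ω i * Y i j * X ω j) -
              ∫ ω', ∑ i, ∑ j, X ω' i * Y i j * X ω' j ∂P| > t}).toReal ≤
          2 * Real.exp (-(c * min (t ^ 2 / (2 * B ^ 4 * ∑ i, ∑ j, Y i j ^ 2))
            (t / (B ^ 2 * ‖Matrix.toEuclideanCLM (𝕜 := ℝ) Y‖)))) := by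
  refine ⟨1 / 16000000, by norm_num, ?_⟩
  intro n Ω _ P _ X B Y hmeas hmean hB hX t ht
  rw [← measureReal_def]
  set N := ‖Matrix.toEuclideanCLM (𝕜 := ℝ) Y‖
  set R := ∑ i, ∑ j, Y i j ^ 2
  set w := min (t ^ 2 / (2 * B ^ 4 * R)) (t / (B ^ 2 * N))
  have hR0 : 0 ≤ R := Finset.sum_nonneg fun i _ => Finset.sum_nonneg fun j _ => sq_nonneg _
  have hw0 : 0 ≤ w := le_min (by positivity) (by positivity)
  set s := √(2 * w) / 2000
  have hs0 : 0 ≤ s := by positivity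
  have hs2 : s ^ 2 = 2 * w / 4000000 := by
    rw [div_pow, Real.sq_sqrt (by positivity)]; norm_num
  rcases lt_or_ge s 2 with hs | hs
  · have h1 : s ^ 2 < 4 := by nlinarith
    have h2 := Real.add_one_le_exp (-(1 / 16000000 * w))
    exact measureReal_le_one.trans (by linarith)
  have hw : 0 < w := by
    have h1 : 4 ≤ s ^ 2 := by nlinarith
    linarith
  have hR : 0 < R := hR0.lt_of_ne' fun h => by simp [w, h] at hw
  have hN : 0 < N := (norm_nonneg _).lt_of_ne' fun (h : N = 0) => by
    have h1 : w ≤ t / (B ^ 2 * N) := min_le_right _ _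
    rw [h, mul_zero, _root_.div_zero] at h1
    linarith
  obtain ⟨v, l, hform, hlN, hlR⟩ := Y.exists_orthonormalBasis_quadraticForm
  set F := √R
  have hF : 0 < F := Real.sqrt_pos.2 hR
  have hF2 : F ^ 2 = R := Real.sq_sqrt hR0
  have hmean' : ∀ i, ∫ ω, v.repr (X ω) i ∂P = 0 := fun i => by
    have hint : ∀ j, Integrable (fun ω => X ω j) P := fun j =>
      (hX.lipschitz hB (φ := fun x => x j) one_pos
        ⟨convex_univ, fun x _ y _ a b _ _ _ => by simp⟩ (fun x y => by
          simpa using PiLp.norm_apply_le (x - y) j)).1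
    simp only [v.repr_apply_apply, PiLp.inner_apply]
    rw [integral_finsetSum _ fun j _ => by simpa using (hint j).mul_const _]
    refine Finset.sum_eq_zero fun j _ => ?_
    simp [integral_mul_const, hmean j]
  have htail := (hX.linearIsometryEquiv v.repr).diagonal_tail hB (by fun_prop) hmean'
    (l := l) (L := min N F) (F := F) (lt_min hN hF)
    (fun i => le_min (hlN i) (by
      refine Real.abs_le_sqrt (le_trans ?_ hlR)
      exact Finset.single_le_sum (f := fun i => l i ^ 2) (fun i _ => sq_nonneg _)
        (Finset.mem_univ i)))
    (min_le_right _ _) (by rwa [hF2]) hs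
  simp only [hform]
  have hFs : B ^ 2 * (F * s) ≤ t / 2000 := by
    have h1 : √(2 * w) ≤ t / (B ^ 2 * F) := by
      refine Real.sqrt_le_iff.2 ⟨by positivity, ?_⟩
      calc 2 * w ≤ 2 * (t ^ 2 / (2 * B ^ 4 * R)) := by gcongr; exact min_le_left _ _
        _ = (t / (B ^ 2 * F)) ^ 2 := by rw [div_pow, mul_pow, hF2]; field_simp
    rw [le_div_iff₀ (by positivity)] at h1
    simp only [s]
    linarith
  have hNs : B ^ 2 * (min N F * s ^ 2) ≤ t / 2000000 := by
    have h1 : w ≤ t / (B ^ 2 * N) := min_le_right _ _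
    rw [le_div_iff₀ (by positivity)] at h1
    calc B ^ 2 * (min N F * s ^ 2) ≤ B ^ 2 * (N * s ^ 2) := by gcongr; exact min_le_left _ _
      _ ≤ _ := by rw [hs2]; linarith
  refine (measureReal_mono fun ω hω => ?_).trans (htail.trans ?_)
  · simp only [Set.mem_ofPred_eq] at hω ⊢
    linarith
  · have h1 : 4 ≤ s ^ 2 := by nlinarith
    have h2 : 4 ≤ Real.exp (7 / 2) := by linarith [Real.add_one_le_exp (7 / 2 : ℝ)]
    calc 8 * Real.exp (-s ^ 2) = 2 * (4 * Real.exp (-s ^ 2)) := by ring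
      _ ≤ 2 * (Real.exp (7 / 2) * Real.exp (-s ^ 2)) := by gcongr
      _ ≤ _ := by
        rw [← Real.exp_add]
        gcongr
        linarith
end

section
/- Let a ∈ ℝ^n be drawn uniformly from the sphere of radius √n in ℝ^n, and let 𝒜 = √(κ(n)) vec(a aᵀ − I_n) with κ(n) = n/(n−1) be the corresponding centered normalized column of the self Khatri–Rao product. Then there is an absolute constant C > 0, independent of n, such that ‖𝒜‖_{ψ₁} = sup_{‖y‖₂=1} ‖⟨𝒜, y⟩‖_{ψ₁} ≤ C. -/
open MeasureTheory ProbabilityTheory Real ENNReal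

/-- The ψ_α Orlicz-type norm of a real random variable, valued in `ℝ≥0∞`
(infimum over admissible constants `K`, `∞` if none exists). -/
noncomputable def psiNorm {Ω : Type*} [MeasurableSpace Ω] (μ : Measure Ω) (α : ℝ)
    (Y : Ω → ℝ) : ℝ≥0∞ :=
  ⨅ K ∈ {K : ℝ | 0 < K ∧ ∫ ω, Real.exp (|Y ω| ^ α / K ^ α) ∂μ ≤ 2}, ENNReal.ofReal K

/-- The ψ_α norm of a random vector: supremum of the ψ_α norms of its
one-dimensional marginals over unit directions. -/
noncomputable def vPsiNorm {Ω : Type*} [MeasurableSpace Ω] (μ : Measure Ω) (α : ℝ)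
    {ι : Type*} [Fintype ι] (X : Ω → ι → ℝ) : ℝ≥0∞ :=
  ⨆ x : {x : ι → ℝ // ∑ i, x i ^ 2 = 1}, psiNorm μ α (fun ω => ∑ i, X ω i * x.1 i)

/-- The centered self Khatri–Rao column `vec(a aᵀ - I_n)`, indexed by `Fin n × Fin n`. -/
def krVec {n : ℕ} (a : Fin n → ℝ) : Fin n × Fin n → ℝ :=
  fun p => a p.1 * a p.2 - if p.1 = p.2 then 1 else 0

lemma one_le_one_sub_mul_exp {y : ℝ} (hy : |y| ≤ 1 / 4) :
    1 ≤ (1 - y) * Real.exp (y + y ^ 2) := by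
  obtain ⟨h1, h2⟩ := abs_le.mp hy
  have hlow : 1 + y + 5 / 4 * y ^ 2 + y ^ 3 / 2 ≤ Real.exp (y + y ^ 2) := by
    have h : 1 + (y + y ^ 2) / 2 ≤ Real.exp ((y + y ^ 2) / 2) := by
      linarith [Real.add_one_le_exp ((y + y ^ 2) / 2)]
    have hsq : Real.exp (y + y ^ 2) = Real.exp ((y + y ^ 2) / 2) ^ 2 := by
      rw [← Real.exp_nat_mul]
      congr 1
      push_cast
      ring
    have h0 : 0 ≤ 1 + (y + y ^ 2) / 2 := by nlinarith
    rw [hsq]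
    refine le_trans ?_ (pow_le_pow_left₀ h0 h 2)
    nlinarith [sq_nonneg (y ^ 2)]
  have hpos : 0 ≤ y ^ 2 * (1 / 4 - 3 / 4 * y - y ^ 2 / 2) :=
    mul_nonneg (sq_nonneg y) (by nlinarith)
  linarith [mul_le_mul_of_nonneg_left hlow (by linarith : (0 : ℝ) ≤ 1 - y)]

lemma gaussianPDFReal_zero_one_mul_exp (x t : ℝ) :
    gaussianPDFReal 0 1 t * Real.exp (x * t ^ 2) =
      (√(2 * π))⁻¹ * Real.exp (-(1 / 2 - x) * t ^ 2) := by
  simp only [gaussianPDFReal_def, NNReal.coe_one, mul_one, sub_zero, mul_assoc,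
    ← Real.exp_add]
  congr 2
  ring

lemma integrable_exp_mul_sq_gaussianReal {x : ℝ} (hx : x < 1 / 2) :
    Integrable (fun t ↦ Real.exp (x * t ^ 2)) (gaussianReal 0 1) := by
  rw [gaussianReal_of_var_ne_zero _ one_ne_zero,
    integrable_withDensity_iff_integrable_smul' (measurable_gaussianPDF _ _)
      (ae_of_all _ fun _ ↦ gaussianPDF_lt_top)]
  simp only [toReal_gaussianPDF, smul_eq_mul, gaussianPDFReal_zero_one_mul_exp]
  exact (integrable_exp_neg_mul_sq (by linarith)).const_mul _

lemma integral_exp_mul_sq_gaussianReal {x : ℝ} (hx : x < 1 / 2) :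
    ∫ t, Real.exp (x * t ^ 2) ∂(gaussianReal 0 1) = (√(1 - 2 * x))⁻¹ := by
  rw [integral_gaussianReal_eq_integral_smul one_ne_zero]
  simp only [smul_eq_mul, gaussianPDFReal_zero_one_mul_exp]
  rw [integral_const_mul, integral_gaussian, ← Real.sqrt_inv, ← Real.sqrt_inv,
    ← Real.sqrt_mul (by positivity)]
  congr 1
  have h1 : 1 - 2 * x ≠ 0 := by linarith
  have h2 : 1 / 2 - x ≠ 0 := by linarith
  field_simp

lemma integral_exp_mul_sq_gaussianReal_le {x : ℝ} (hx : |x| ≤ 1 / 8) :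
    ∫ t, Real.exp (x * t ^ 2) ∂(gaussianReal 0 1) ≤ Real.exp (x + 2 * x ^ 2) := by
  have h2 : x ≤ 1 / 8 := (abs_le.mp hx).2
  rw [integral_exp_mul_sq_gaussianReal (by linarith)]
  have h := one_le_one_sub_mul_exp (y := 2 * x) (by rw [abs_mul, abs_two]; linarith)
  rw [inv_le_iff_one_le_mul₀ (Real.sqrt_pos.mpr (by linarith)), mul_comm]
  refine (sq_le_sq₀ zero_le_one (by positivity)).mp ?_
  rw [one_pow, mul_pow, Real.sq_sqrt (by linarith), ← Real.exp_nat_mul]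
  have hexp : ((2 : ℕ) : ℝ) * (x + 2 * x ^ 2) = 2 * x + (2 * x) ^ 2 := by
    push_cast
    ring
  rwa [hexp]

lemma exp_sum_mul_sq_inner {E ι : Type*} [NormedAddCommGroup E]
    [InnerProductSpace ℝ E] [Fintype ι] (b : OrthonormalBasis ι ℝ E) (d x : ι → ℝ) :
    Real.exp (∑ i, d i * inner ℝ (b i) (∑ j, x j • b j) ^ 2) =
      ∏ i, Real.exp (d i * x i ^ 2) := by
  rw [Real.exp_sum]
  congr! 4 with i
  exact b.orthonormal.inner_right_fintype x i

section

variable {E : Type*} [NormedAddCommGroup E] [InnerProductSpace ℝ E] [FiniteDimensional ℝ E]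
  [MeasurableSpace E] [BorelSpace E] {ι : Type*} [Fintype ι]

lemma integrable_exp_sum_mul_sq_stdGaussian (b : OrthonormalBasis ι ℝ E) {d : ι → ℝ}
    (hd : ∀ i, d i < 1 / 2) :
    Integrable (fun g ↦ Real.exp (∑ i, d i * inner ℝ (b i) g ^ 2)) (stdGaussian E) := by
  rw [stdGaussian_eq_map_pi_orthonormalBasis b,
    integrable_map_measure (Measurable.aestronglyMeasurable (by fun_prop))
      (Measurable.aemeasurable (by fun_prop))]
  simp only [Function.comp_def, exp_sum_mul_sq_inner]
  exact Integrable.fintype_prod fun i ↦ integrable_exp_mul_sq_gaussianReal (hd i)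

lemma integral_exp_sum_mul_sq_stdGaussian_le (b : OrthonormalBasis ι ℝ E) {d : ι → ℝ}
    (hd : ∀ i, |d i| ≤ 1 / 8) :
    ∫ g, Real.exp (∑ i, d i * inner ℝ (b i) g ^ 2) ∂(stdGaussian E) ≤
      Real.exp (∑ i, d i + 2 * ∑ i, d i ^ 2) := by
  rw [stdGaussian_eq_map_pi_orthonormalBasis b,
    integral_map (Measurable.aemeasurable (by fun_prop))
      (Measurable.aestronglyMeasurable (by fun_prop))]
  simp only [exp_sum_mul_sq_inner]
  rw [integral_fintype_prod_eq_prod (f := fun i t ↦ Real.exp (d i * t ^ 2)), Finset.mul_sum,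
    ← Finset.sum_add_distrib, Real.exp_sum]
  exact Finset.prod_le_prod (fun i _ ↦ integral_nonneg fun t ↦ (Real.exp_pos _).le)
    fun i _ ↦ integral_exp_mul_sq_gaussianReal_le (hd i)

lemma integrable_norm_sq_stdGaussian :
    Integrable (fun g : E ↦ ‖g‖ ^ 2) (stdGaussian E) :=
  (IsGaussian.memLp_two_id (μ := stdGaussian E)).integrable_norm_pow (by norm_num)

lemma integral_norm_sq_stdGaussian :
    ∫ g : E, ‖g‖ ^ 2 ∂(stdGaussian E) = Module.finrank ℝ E := by
  have h (i) : Integrable (fun g : E ↦ inner ℝ (stdOrthonormalBasis ℝ E i) g ^ 2)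
      (stdGaussian E) := by
    refine integrable_norm_sq_stdGaussian.mono' (Measurable.aestronglyMeasurable (by fun_prop))
      (ae_of_all _ fun g ↦ ?_)
    have := abs_real_inner_le_norm (stdOrthonormalBasis ℝ E i) g
    rw [OrthonormalBasis.norm_eq_one, one_mul] at this
    simpa using pow_le_pow_left₀ (abs_nonneg _) this 2
  have h1 (i) : ∫ g : E, inner ℝ (stdOrthonormalBasis ℝ E i) g ^ 2 ∂(stdGaussian E) = 1 := by
    have hv := variance_dual_stdGaussian (innerSL ℝ (stdOrthonormalBasis ℝ E i))
    rw [variance_of_integral_eq_zero (by fun_prop) (integral_strongDual_stdGaussian _)] at hv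
    simpa using hv
  simp_rw [← (stdOrthonormalBasis ℝ E).sum_sq_inner_right]
  rw [integral_finsetSum _ fun i _ ↦ h i]
  simp [h1]

/-- A random vector with rotation-invariant law on a sphere, rescaled by an independent Gaussian
norm, is a standard Gaussian vector. -/
lemma map_norm_smul_prod_eq_stdGaussian {μ : Measure E} [IsProbabilityMeasure μ] {R : ℝ}
    (hR : 0 < R) (hμ : ∀ᵐ a ∂μ, ‖a‖ = R)
    (hinv : ∀ O : E ≃ₗᵢ[ℝ] E, μ.map O = μ) :
    ((stdGaussian E).prod μ).map (fun p ↦ (‖p.1‖ / R) • p.2) = stdGaussian E := by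
  have hchar {x y : E} (hxy : ‖x‖ = ‖y‖) : charFun μ x = charFun μ y := by
    set O := (ℝ ∙ (x - y))ᗮ.reflection
    have hO : O x = y := Submodule.reflection_sub hxy
    conv_rhs => rw [← hinv O]
    rw [charFun_apply, charFun_apply, integral_map (by fun_prop)
      (Measurable.aestronglyMeasurable (by fun_prop))]
    simp [← hO]
  have hfint {f : E × E → ℝ} (hf : Measurable f) :
      Integrable (fun p ↦ Complex.exp (f p * Complex.I)) ((stdGaussian E).prod μ) := by
    refine Integrable.of_bound (Measurable.aestronglyMeasurable (by fun_prop)) 1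
      (ae_of_all _ fun p ↦ ?_)
    simp
  have : IsProbabilityMeasure
      (((stdGaussian E).prod μ).map (fun p ↦ (‖p.1‖ / R) • p.2)) :=
    Measure.isProbabilityMeasure_map (by fun_prop)
  refine Measure.ext_of_charFun (funext fun x ↦ ?_)
  calc charFun (((stdGaussian E).prod μ).map (fun p ↦ (‖p.1‖ / R) • p.2)) x
      = ∫ g, charFun μ ((‖g‖ / R) • x) ∂(stdGaussian E) := by
        rw [charFun_apply, integral_map (by fun_prop)
          (Measurable.aestronglyMeasurable (by fun_prop)), integral_prod _ (hfint (by fun_prop))]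
        simp [charFun_apply, inner_smul_left, inner_smul_right]
    _ = ∫ g, charFun μ ((‖x‖ / R) • g) ∂(stdGaussian E) := by
        congr! 2 with g
        refine hchar ?_
        simp only [norm_smul, norm_div, norm_norm]
        ring
    _ = ∫ a, charFun (stdGaussian E) ((‖x‖ / R) • a) ∂μ := by
        simp only [charFun_apply]
        rw [integral_integral_swap]
        · simp [inner_smul_right, real_inner_comm]
        · exact hfint (f := fun p ↦ inner ℝ p.2 ((‖x‖ / R) • p.1)) (by fun_prop)
    _ = ∫ a, charFun (stdGaussian E) x ∂μ := by
        refine integral_congr_ae ?_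
        filter_upwards [hμ] with a ha
        rw [charFun_stdGaussian, charFun_stdGaussian, norm_smul, ha, norm_div, norm_norm,
          Real.norm_of_nonneg hR.le, div_mul_cancel₀ _ hR.ne']
    _ = charFun (stdGaussian E) x := by simp

/-- The exponential moment of a quadratic form on a sphere of radius `√(dim E)` is at most the
one of the same form at a standard Gaussian vector. -/
lemma integral_exp_le_integral_exp_stdGaussian {μ : Measure E} [IsProbabilityMeasure μ]
    (hE : 0 < Module.finrank ℝ E) (hμ : ∀ᵐ a ∂μ, ‖a‖ = √(Module.finrank ℝ E))
    (hinv : ∀ O : E ≃ₗᵢ[ℝ] E, μ.map O = μ) {q : E → ℝ} (hq : Measurable q)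
    (hq2 : ∀ (c : ℝ) x, q (c • x) = c ^ 2 * q x)
    (hfint : Integrable (fun g ↦ Real.exp (q g)) (stdGaussian E)) :
    ∫ a, Real.exp (q a) ∂μ ≤ ∫ g, Real.exp (q g) ∂(stdGaussian E) := by
  have hn : (0 : ℝ) < Module.finrank ℝ E := by exact_mod_cast hE
  have hpolar := map_norm_smul_prod_eq_stdGaussian (Real.sqrt_pos.mpr hn) hμ hinv
  set n : ℝ := (Module.finrank ℝ E : ℝ)
  have heq (p : E × E) : q ((‖p.1‖ / √n) • p.2) = ‖p.1‖ ^ 2 / n * q p.2 := by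
    rw [hq2, div_pow, Real.sq_sqrt hn.le]
  have hpint : Integrable (fun p : E × E ↦ Real.exp (‖p.1‖ ^ 2 / n * q p.2))
      ((stdGaussian E).prod μ) := by
    rw [← hpolar, integrable_map_measure (Measurable.aestronglyMeasurable (by fun_prop))
      (by fun_prop)] at hfint
    simpa only [Function.comp_def, heq] using hfint
  calc ∫ a, Real.exp (q a) ∂μ
      ≤ ∫ a, ∫ g, Real.exp (‖g‖ ^ 2 / n * q a) ∂(stdGaussian E) ∂μ := by
        refine integral_mono_of_nonneg (ae_of_all _ fun a ↦ (Real.exp_pos _).le)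
          hpint.integral_prod_right ?_
        filter_upwards [hpint.prod_left_ae] with a ha
        have hs : Integrable (fun g : E ↦ ‖g‖ ^ 2 / n) (stdGaussian E) :=
          integrable_norm_sq_stdGaussian.div_const n
        have hs1 : ∫ g : E, ‖g‖ ^ 2 / n ∂(stdGaussian E) = 1 := by
          rw [integral_div, integral_norm_sq_stdGaussian, div_self hn.ne']
        calc Real.exp (q a)
            = ∫ g : E, Real.exp (q a) * (1 - q a + q a * (‖g‖ ^ 2 / n)) ∂(stdGaussian E) := by
              rw [integral_const_mul, integral_add (integrable_const _) (hs.const_mul _),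
                integral_const_mul, hs1]
              simp
          _ ≤ ∫ g, Real.exp (‖g‖ ^ 2 / n * q a) ∂(stdGaussian E) := by
              refine integral_mono (((integrable_const _).add (hs.const_mul _)).const_mul _) ha
                fun g ↦ ?_
              have h : Real.exp (‖g‖ ^ 2 / n * q a) =
                  Real.exp (q a) * Real.exp ((‖g‖ ^ 2 / n - 1) * q a) := by
                rw [← Real.exp_add]
                ring_nf
              simp only [h]
              gcongr
              linarith [Real.add_one_le_exp ((‖g‖ ^ 2 / n - 1) * q a)]
    _ = ∫ p, Real.exp (‖p.1‖ ^ 2 / n * q p.2) ∂((stdGaussian E).prod μ) :=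
        (integral_prod_symm _ hpint).symm
    _ = ∫ g, Real.exp (q g) ∂(stdGaussian E) := by
        conv_rhs => rw [← hpolar, integral_map (by fun_prop)
          (Measurable.aestronglyMeasurable (by fun_prop))]
        simp only [heq]

lemma integral_exp_abs_half_le_two {μ : Measure E} [IsProbabilityMeasure μ]
    (hE : 0 < Module.finrank ℝ E) (hμ : ∀ᵐ a ∂μ, ‖a‖ = √(Module.finrank ℝ E))
    (hinv : ∀ O : E ≃ₗᵢ[ℝ] E, μ.map O = μ) (b : OrthonormalBasis ι ℝ E) {d : ι → ℝ}
    (hd0 : ∑ i, d i = 0) (hd : ∑ i, d i ^ 2 ≤ 1 / 64) :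
    ∫ a, Real.exp (|∑ i, d i * inner ℝ (b i) a ^ 2| / 2) ∂μ ≤ 2 := by
  have hexp (c : ι → ℝ) (hc0 : ∑ i, c i = 0) (hc : ∑ i, c i ^ 2 ≤ 1 / 64) :
      Integrable (fun a ↦ Real.exp (∑ i, c i * inner ℝ (b i) a ^ 2)) μ ∧
        ∫ a, Real.exp (∑ i, c i * inner ℝ (b i) a ^ 2) ∂μ ≤ 2 := by
    have hci (i) : |c i| ≤ 1 / 8 := by
      have h := Finset.single_le_sum (f := fun i ↦ c i ^ 2) (fun j _ ↦ sq_nonneg _)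
        (Finset.mem_univ i)
      exact abs_le_of_sq_le_sq (by linarith) (by norm_num)
    refine ⟨?_, ?_⟩
    · refine Integrable.of_bound (Measurable.aestronglyMeasurable (by fun_prop))
        (Real.exp (∑ _i : ι, 1 / 8 * √(Module.finrank ℝ E) ^ 2)) ?_
      filter_upwards [hμ] with a ha
      rw [Real.norm_of_nonneg (Real.exp_pos _).le]
      refine Real.exp_le_exp.mpr (Finset.sum_le_sum fun i _ ↦ ?_)
      have h := abs_real_inner_le_norm (b i) a
      rw [b.norm_eq_one, one_mul, ha] at h
      exact mul_le_mul ((le_abs_self _).trans (hci i))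
        (sq_le_sq' (neg_le_of_abs_le h) (le_of_abs_le h)) (sq_nonneg _) (by norm_num)
    · refine (integral_exp_le_integral_exp_stdGaussian hE hμ hinv (by fun_prop) ?_ ?_).trans
        ((integral_exp_sum_mul_sq_stdGaussian_le b hci).trans ?_)
      · intro s x
        simp only [inner_smul_right, Finset.mul_sum]
        congr! 1 with i
        ring
      · exact integrable_exp_sum_mul_sq_stdGaussian b
          fun i ↦ (le_abs_self _).trans_lt ((hci i).trans_lt (by norm_num))
      · have h1 : ∑ i, c i + 2 * ∑ i, c i ^ 2 ≤ 1 / 2 := by linarith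
        have h2 : Real.exp (1 / 2) ^ 2 ≤ 2 ^ 2 := by
          rw [← Real.exp_nat_mul]
          norm_num
          linarith [Real.exp_one_lt_d9]
        exact (Real.exp_le_exp.mpr h1).trans (le_of_sq_le_sq h2 (by norm_num))
  obtain ⟨hi1, hle1⟩ := hexp d hd0 hd
  obtain ⟨hi2, hle2⟩ := hexp (fun i ↦ -d i) (by simp [hd0]) (by simpa using hd)
  simp only [neg_mul, Finset.sum_neg_distrib] at hi2 hle2
  have hbound (u : ℝ) : Real.exp (|u| / 2) ≤ (Real.exp u + Real.exp (-u) + 4) / 4 := by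
    have h1 : Real.exp |u| = Real.exp (|u| / 2) ^ 2 := by
      rw [← Real.exp_nat_mul]
      congr 1
      push_cast
      ring
    have h2 : Real.exp |u| ≤ Real.exp u + Real.exp (-u) := Real.exp_abs_le u
    nlinarith [sq_nonneg (Real.exp (|u| / 2) - 2)]
  have hi : Integrable (fun a ↦ (Real.exp (∑ i, d i * inner ℝ (b i) a ^ 2) +
      Real.exp (-∑ i, d i * inner ℝ (b i) a ^ 2) + 4) / 4) μ :=
    ((hi1.add hi2).add (integrable_const 4)).div_const 4
  have hfint : Integrable (fun a ↦ Real.exp (|∑ i, d i * inner ℝ (b i) a ^ 2| / 2)) μ := by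
    refine hi.mono' (Measurable.aestronglyMeasurable (by fun_prop)) (ae_of_all _ fun a ↦ ?_)
    rw [Real.norm_of_nonneg (Real.exp_pos _).le]
    exact hbound _
  refine (integral_mono hfint hi fun a ↦ hbound _).trans ?_
  rw [integral_div, integral_add (by exact hi1.add hi2) (integrable_const _),
    integral_add hi1 hi2]
  simp only [integral_const, probReal_univ, one_smul]
  linarith

end

/-- Diagonalization of the quadratic form with coefficient matrix `Y`, with control of the
eigenvalues of its symmetric part. -/
lemma exists_orthonormalBasis_quadratic {ι : Type*} [Fintype ι] [DecidableEq ι]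
    (Y : ι × ι → ℝ) :
    ∃ (b : OrthonormalBasis ι ℝ (EuclideanSpace ℝ ι)) (d : ι → ℝ),
      (∀ a : EuclideanSpace ℝ ι,
        ∑ p : ι × ι, a p.1 * a p.2 * Y p = ∑ i, d i * inner ℝ (b i) a ^ 2) ∧
      ∑ i, d i = ∑ i, Y (i, i) ∧ ∑ i, d i ^ 2 ≤ ∑ p, Y p ^ 2 := by
  set H : Matrix ι ι ℝ := Matrix.of fun i j ↦ (Y (i, j) + Y (j, i)) / 2 with hHdef
  have hH : H.IsHermitian := by
    ext i j
    simp [hHdef, add_comm]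
  set T := H.toEuclideanLin
  have hT : T.IsSymmetric := Matrix.isSymmetric_toEuclideanLin_iff.mpr hH
  have hTb (i) : T (hH.eigenvectorBasis i) = hH.eigenvalues i • hH.eigenvectorBasis i := by
    ext j
    simpa [T, Matrix.toLpLin_apply] using congrFun (hH.mulVec_eigenvectorBasis i) j
  refine ⟨hH.eigenvectorBasis, hH.eigenvalues, fun a ↦ ?_, ?_, ?_⟩
  · have h1 : inner ℝ a (T a) = ∑ i, hH.eigenvalues i * inner ℝ (hH.eigenvectorBasis i) a ^ 2 := by
      rw [← hH.eigenvectorBasis.sum_inner_mul_inner]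
      congr! 1 with i
      rw [← hT, hTb, real_inner_smul_left, real_inner_comm]
      ring
    have h2 : inner ℝ a (T a) = ∑ i, ∑ j, a i * a j * H i j := by
      simp only [PiLp.inner_apply, T, Matrix.toLpLin_apply, Matrix.mulVec, dotProduct]
      simp [Finset.mul_sum, mul_comm, mul_assoc]
    have h3 : ∑ i, ∑ j, a i * a j * Y (j, i) = ∑ i, ∑ j, a i * a j * Y (i, j) := by
      rw [Finset.sum_comm]
      simp only [mul_comm]
    rw [← h1, h2, Fintype.sum_prod_type]
    simp only [hHdef, Matrix.of_apply, mul_div_assoc', mul_add, ← Finset.sum_div,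
      Finset.sum_add_distrib, h3]
    ring
  · have h := hH.trace_eq_sum_eigenvalues
    simp only [RCLike.ofReal_real_eq_id, id] at h
    rw [← h]
    simp [Matrix.trace, hHdef]
  · have h1 : ∑ i, hH.eigenvalues i ^ 2 = ∑ j, ∑ i, H i j ^ 2 := by
      calc ∑ i, hH.eigenvalues i ^ 2
          = ∑ i, ‖T (hH.eigenvectorBasis i)‖ ^ 2 := by
            simp [hTb, norm_smul]
        _ = ∑ i, ∑ j, inner ℝ (hH.eigenvectorBasis i) (T (EuclideanSpace.basisFun ι ℝ j)) ^ 2 := by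
            congr! 1 with i
            rw [← (EuclideanSpace.basisFun ι ℝ).sum_sq_inner_left]
            simp only [hT _ _]
        _ = ∑ j, ‖T (EuclideanSpace.basisFun ι ℝ j)‖ ^ 2 := by
            rw [Finset.sum_comm]
            simp only [OrthonormalBasis.sum_sq_inner_right]
        _ = ∑ j, ∑ i, H i j ^ 2 := by
            simp [EuclideanSpace.real_norm_sq_eq, T, Matrix.toLpLin_apply]
    have h2 : ∑ j, ∑ i, H i j ^ 2 ≤ ∑ j, ∑ i, (Y (i, j) ^ 2 + Y (j, i) ^ 2) / 2 := by
      gcongr with j _ i _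
      simp only [hHdef, Matrix.of_apply]
      nlinarith [sq_nonneg (Y (i, j) - Y (j, i))]
    have h3 : ∑ j, ∑ i, Y (i, j) ^ 2 = ∑ j, ∑ i, Y (j, i) ^ 2 := Finset.sum_comm
    simp only [← Finset.sum_div, Finset.sum_add_distrib, h3] at h2
    rw [h1, Fintype.sum_prod_type]
    linarith

/-- For `a` uniform on the sphere of radius `√n` (encoded by being a.s. on the sphere
with rotation-invariant law), the centered normalized Khatri–Rao column
`√(n/(n-1)) vec(a aᵀ - I_n)` has `ψ₁`-norm bounded by an absolute constant. -/
theorem kr_column_spherical_subexponential :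
    ∃ C > (0:ℝ), ∀ (n : ℕ) (Ω : Type) (_ : MeasurableSpace Ω)
      (P : Measure Ω) (_ : IsProbabilityMeasure P) (a : Ω → EuclideanSpace ℝ (Fin n)),
      2 ≤ n →
      Measurable a →
      (∀ᵐ ω ∂P, ‖a ω‖ = Real.sqrt n) →
      (∀ O : EuclideanSpace ℝ (Fin n) ≃ₗᵢ[ℝ] EuclideanSpace ℝ (Fin n),
        Measure.map (fun ω => O (a ω)) P = Measure.map a P) →
      vPsiNorm P 1
          (fun ω p => Real.sqrt ((n : ℝ) / (n - 1)) * krVec (fun i => a ω i) p) ≤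
        ENNReal.ofReal C := by
  refine ⟨32, by norm_num, fun n Ω _ P _ a hn ha hnorm hinv ↦ iSup_le fun ⟨x, hx⟩ ↦ ?_⟩
  obtain ⟨b, d, hquad, htr, hsq⟩ := exists_orthonormalBasis_quadratic x
  have hn' : (2 : ℝ) ≤ n := by exact_mod_cast hn
  set κ : ℝ := √((n : ℝ) / (n - 1))
  have hκ : κ ^ 2 ≤ 2 := by
    rw [Real.sq_sqrt (div_nonneg (by linarith) (by linarith)), div_le_iff₀ (by linarith)]
    linarith
  set m : ℝ := (∑ i, d i) / n with hm
  have hmn : n * m = ∑ i, d i := by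
    rw [hm]
    field_simp
  set c : Fin n → ℝ := fun i ↦ κ / 16 * (d i - m) with hc
  have hc0 : ∑ i, c i = 0 := by
    simp [hc, ← Finset.mul_sum, hmn]
  have hdm : ∑ i, (d i - m) ^ 2 ≤ 1 := by
    have h : ∑ i, (d i - m) ^ 2 = ∑ i, d i ^ 2 - n * m ^ 2 := by
      simp only [sub_sq, Finset.sum_add_distrib, Finset.sum_sub_distrib, ← Finset.sum_mul,
        ← Finset.mul_sum, ← hmn]
      simp
      ring
    nlinarith [sq_nonneg m]
  have hc2 : ∑ i, c i ^ 2 ≤ 1 / 64 := by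
    simp only [hc, mul_pow, ← Finset.mul_sum]
    nlinarith [sq_nonneg κ]
  have : IsProbabilityMeasure (P.map a) := Measure.isProbabilityMeasure_map ha.aemeasurable
  have hle := (integral_exp_abs_half_le_two (μ := P.map a) (by simp; omega)
    ((ae_map_iff ha.aemeasurable (measurableSet_eq_fun (by fun_prop) (by fun_prop))).mpr
      (by simpa using hnorm))
    (fun O ↦ by rw [Measure.map_map (by fun_prop) ha]; exact hinv O) b hc0 hc2)
  rw [integral_map ha.aemeasurable (Measurable.aestronglyMeasurable (by fun_prop))] at hle
  refine iInf₂_le_of_le 32 ⟨by norm_num, le_of_eq_of_le (integral_congr_ae ?_) hle⟩ le_rfl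
  filter_upwards [hnorm] with ω hω
  have hsum : ∑ i, inner ℝ (b i) (a ω) ^ 2 = n := by
    rw [b.sum_sq_inner_right, hω, Real.sq_sqrt (by positivity)]
  have hlin : ∑ p, κ * krVec (fun i ↦ a ω i) p * x p =
      16 * ∑ i, c i * inner ℝ (b i) (a ω) ^ 2 := by
    have h1 : ∑ p, κ * krVec (fun i ↦ a ω i) p * x p =
        κ * (∑ p, a ω p.1 * a ω p.2 * x p - ∑ i, x (i, i)) := by
      have h2 : ∑ i, x (i, i) = ∑ p : Fin n × Fin n, (if p.1 = p.2 then 1 else 0) * x p := by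
        simp [Fintype.sum_prod_type]
      rw [h2, ← Finset.sum_sub_distrib, Finset.mul_sum]
      congr! 1 with p
      rw [krVec]
      ring
    have h3 : ∑ i, c i * inner ℝ (b i) (a ω) ^ 2 =
        κ / 16 * (∑ i, d i * inner ℝ (b i) (a ω) ^ 2 - m * ∑ i, inner ℝ (b i) (a ω) ^ 2) := by
      rw [Finset.mul_sum, ← Finset.sum_sub_distrib, Finset.mul_sum]
      congr! 1 with i
      simp only [hc]
      ring
    rw [h1, h3, hquad, ← htr, hsum, ← hmn]
    ring
  simp only [Real.rpow_one]
  rw [hlin, abs_mul, abs_of_pos (by norm_num : (0 : ℝ) < 16)]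
  congr 1
  ring
end
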